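/- Let y > 2 be a real number, let q = ∏_{p prime, p < y} p, let μ = Σ_{p prime, p < y} 1/p and let σ = (Σ_{p prime, p < y} (1/p)·(1 − 1/p))^(1/2). Then for every nonnegative integer a, the number of integers x with a < x ≤ a + q satisfying f(x) > μ − 2σ is at least q/2. -/

import Mathlib

open scoped Classical in
/-- The finite set of primes `p < y`. -/
noncomputable def primesLT (y : ℝ) : Finset ℕ :=
  (Finset.range (Nat.ceil y)).filter (fun p => Nat.Prime p ∧ (p : ℝ) < y)

open scoped Classical in
/-- `f x` is the number of primes `p < y` dividing `x`. -/
noncomputable def fCount (y : ℝ) (x : ℕ) : ℕ :=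
  ((primesLT y).filter (fun p => p ∣ x)).card

open scoped Classical in
/-- In `q` consecutive integers there are exactly `q / d` multiples of a divisor `d` of `q`. -/
theorem sum_ite_dvd_Icc {d q : ℕ} (hd : 0 < d) (hdq : d ∣ q) (a : ℕ) :
    ∑ x ∈ Finset.Icc (a + 1) (a + q), (if d ∣ x then (1 : ℝ) else 0) = (q : ℝ) / d := by
  obtain ⟨k, rfl⟩ := hdq
  have hd' : (d : ℝ) ≠ 0 := by positivity
  have h := Nat.Ioc_filter_modEq_card a (a + d * k) hd 0
  have hfloor : ⌊(((a + d * k : ℕ) : ℚ) - (0 : ℕ)) / d⌋ = ⌊((a : ℚ) - (0 : ℕ)) / d⌋ + k := by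
    rw [← Int.floor_add_natCast]
    congr 1
    push_cast
    field_simp
    ring
  rw [hfloor, add_sub_cancel_left, max_eq_left (Int.natCast_nonneg k)] at h
  have h' : ((Finset.Ioc a (a + d * k)).filter (fun x => x ≡ 0 [MOD d])).card = k := by
    exact_mod_cast h
  have hI : Finset.Icc (a + 1) (a + d * k) = Finset.Ioc a (a + d * k) := by
    ext x; simp
  simp only [Nat.modEq_zero_iff_dvd] at h'
  rw [Finset.sum_boole, hI, eq_div_iff hd']
  push_cast
  rw [mul_comm]
  congr 2

open scoped Classical in
/-- The covariance of the divisibility indicators of two primes over a period. -/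
theorem sum_centered_dvd_mul {p r q : ℕ} (hp : p.Prime) (hr : r.Prime) (hpq : p ∣ q)
    (hrq : r ∣ q) (a : ℕ) :
    ∑ x ∈ Finset.Icc (a + 1) (a + q),
      ((if p ∣ x then (1 : ℝ) else 0) - 1 / p) * ((if r ∣ x then (1 : ℝ) else 0) - 1 / r) =
      if p = r then (q : ℝ) * ((1 / (p : ℝ)) * (1 - 1 / (p : ℝ))) else 0 := by
  have hp0 : (p : ℝ) ≠ 0 := by exact_mod_cast hp.ne_zero
  have hr0 : (r : ℝ) ≠ 0 := by exact_mod_cast hr.ne_zero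
  have hexp : ∀ x : ℕ, ((if p ∣ x then (1 : ℝ) else 0) - 1 / p) *
      ((if r ∣ x then (1 : ℝ) else 0) - 1 / r) =
      (if p.lcm r ∣ x then (1 : ℝ) else 0) - (if p ∣ x then (1 : ℝ) else 0) * (1 / r)
        - (if r ∣ x then (1 : ℝ) else 0) * (1 / p) + 1 / p * (1 / r) := by
    intro x
    simp only [Nat.lcm_dvd_iff]
    by_cases h₁ : p ∣ x <;> by_cases h₂ : r ∣ x <;> simp [h₁, h₂] <;> ring
  simp only [hexp, Finset.sum_add_distrib, Finset.sum_sub_distrib, ← Finset.sum_mul,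
    sum_ite_dvd_Icc hp.pos hpq, sum_ite_dvd_Icc hr.pos hrq,
    sum_ite_dvd_Icc (Nat.lcm_pos hp.pos hr.pos) (Nat.lcm_dvd hpq hrq),
    Finset.sum_const, Nat.card_Icc, nsmul_eq_mul]
  have hcard : a + q + 1 - (a + 1) = q := by omega
  rw [hcard]
  split_ifs with h
  · subst h
    rw [Nat.lcm_self]
    field_simp
    ring
  · rw [((Nat.coprime_primes hp hr).2 h).lcm_eq_mul]
    push_cast
    field_simp
    ring

theorem prime_of_mem_primesLT {y : ℝ} {p : ℕ} (hp : p ∈ primesLT y) : p.Prime := by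
  simp only [primesLT, Finset.mem_filter] at hp
  exact hp.2.1

theorem two_mem_primesLT {y : ℝ} (hy : 2 < y) : 2 ∈ primesLT y := by
  simp only [primesLT, Finset.mem_filter, Finset.mem_range, Nat.lt_ceil]
  exact ⟨by exact_mod_cast hy, Nat.prime_two, by exact_mod_cast hy⟩

open scoped Classical in
/-- The second central moment of `fCount y` over a period. -/
theorem sum_fCount_sub_sq (y : ℝ) (a : ℕ) :
    ∑ x ∈ Finset.Icc (a + 1) (a + ∏ p ∈ primesLT y, p),
      ((fCount y x : ℝ) - ∑ p ∈ primesLT y, (1 : ℝ) / p) ^ 2 =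
    ((∏ p ∈ primesLT y, p : ℕ) : ℝ) *
      ∑ p ∈ primesLT y, (1 / (p : ℝ)) * (1 - 1 / (p : ℝ)) := by
  have hf : ∀ x : ℕ, (fCount y x : ℝ) - ∑ p ∈ primesLT y, (1 : ℝ) / p =
      ∑ p ∈ primesLT y, ((if p ∣ x then (1 : ℝ) else 0) - 1 / p) := by
    intro x
    rw [Finset.sum_sub_distrib, Finset.sum_boole, fCount]
  simp only [hf, sq, Finset.sum_mul_sum]
  rw [Finset.sum_comm, Finset.mul_sum]
  refine Finset.sum_congr rfl fun p hp => ?_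
  rw [Finset.sum_comm]
  rw [Finset.sum_congr rfl fun r hr => sum_centered_dvd_mul (prime_of_mem_primesLT hp)
    (prime_of_mem_primesLT hr) (Finset.dvd_prod_of_mem _ hp) (Finset.dvd_prod_of_mem _ hr) a]
  rw [Finset.sum_ite_eq, if_pos hp]

open scoped Classical in
/-- For `y > 2`, `q = ∏_{p prime, p < y} p`, `μ = Σ_{p prime, p < y} 1/p` and
`σ = (Σ_{p prime, p < y} (1/p)·(1 − 1/p))^(1/2)`, for every nonnegative integer `a`, the
number of integers `x` with `a < x ≤ a + q` satisfying `f(x) > μ − 2σ` is at least `q/2`. -/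
theorem count_large_fCount_over_period (y : ℝ) (hy : 2 < y) (q : ℕ)
    (hq : q = ∏ p ∈ primesLT y, p) (μ σ : ℝ)
    (hμ : μ = ∑ p ∈ primesLT y, (1 : ℝ) / p)
    (hσ : σ = (∑ p ∈ primesLT y, (1 / (p : ℝ)) * (1 - 1 / (p : ℝ))) ^ ((1 : ℝ) / 2)) (a : ℕ) :
    (q : ℝ) / 2 ≤
      (((Finset.Icc (a + 1) (a + q)).filter
        (fun x => μ - 2 * σ < (fCount y x : ℝ))).card : ℝ) := by

  set V : ℝ := ∑ p ∈ primesLT y, (1 / (p : ℝ)) * (1 - 1 / (p : ℝ)) with hV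
  have hterm : ∀ p ∈ primesLT y, 0 < (1 / (p : ℝ)) * (1 - 1 / (p : ℝ)) := by
    intro p hp
    have h1 : (1 : ℝ) < p := by exact_mod_cast (prime_of_mem_primesLT hp).one_lt
    have h2 : 1 / (p : ℝ) < 1 := (div_lt_one (by linarith)).2 h1
    exact mul_pos (by positivity) (by linarith)
  have hVpos : 0 < V := Finset.sum_pos hterm ⟨2, two_mem_primesLT hy⟩
  rw [← Real.sqrt_eq_rpow] at hσ
  have hσ0 : 0 ≤ σ := hσ ▸ Real.sqrt_nonneg V
  have hσ2 : σ ^ 2 = V := by rw [hσ, Real.sq_sqrt hVpos.le]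
  have hmoment : ∑ x ∈ Finset.Icc (a + 1) (a + q), ((fCount y x : ℝ) - μ) ^ 2 = q * V := by
    rw [hq, hμ, hV]
    exact sum_fCount_sub_sq y a
  set I := Finset.Icc (a + 1) (a + q) with hI
  have hbad : ((I.filter (fun x => ¬ μ - 2 * σ < (fCount y x : ℝ))).card : ℝ) * (4 * V) ≤
      q * V := by
    rw [← hmoment, ← nsmul_eq_mul]
    refine (Finset.card_nsmul_le_sum _ (fun x => ((fCount y x : ℝ) - μ) ^ 2) _ ?_).trans
      (Finset.sum_le_sum_of_subset_of_nonneg (Finset.filter_subset _ _)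
        fun _ _ _ => sq_nonneg _)
    intro x hx
    have hx' := not_lt.1 (Finset.mem_filter.1 hx).2
    nlinarith
  have hsplit : ((I.filter (fun x => μ - 2 * σ < (fCount y x : ℝ))).card : ℝ) +
      (I.filter (fun x => ¬ μ - 2 * σ < (fCount y x : ℝ))).card = q := by
    have h := Finset.card_filter_add_card_filter_not (s := I)
      (fun x => μ - 2 * σ < (fCount y x : ℝ))
    have hcard : I.card = q := by
      rw [hI, Nat.card_Icc]
      omega
    rw [hcard] at h
    exact_mod_cast h
  have hbad' : ((I.filter (fun x => ¬ μ - 2 * σ < (fCount y x : ℝ))).card : ℝ) * 4 ≤ q := by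
    refine le_of_mul_le_mul_right ?_ hVpos
    linarith
  have hq0 : (0 : ℝ) ≤ q := q.cast_nonneg
  linarith
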